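/- Let A = (a_{ij})_{m×m} with entries in a noncommutative ring such that the first m-1 columns satisfy the 𝐪-Cartier-Foata (or 𝐪-right-quantum) relations, i.e. (a_{ij})_{m×(m-1)} is 𝐪-Cartier-Foata (resp. 𝐪-right-quantum). Then ((I - A_{[mm]})^{-1})_{mm} = det_𝐪(I-A)^{-1} · det_𝐪(I - A^{mm}), where A^{mm} is A with the last row and column removed and A_{[mm]} is A with entry a_{kl} rescaled by q_{km}^{-1} when k < m. -/

import Mathlib

/-- The multiparameter quantum determinant `det_𝐪 (D_S - b)`, where `D_S` is the 0/1
diagonal matrix with `1` exactly on the diagonal positions in `S`, and `row` gives the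
global row index attached to each local index (governing the weights). -/
noncomputable def qdetDQ {R : Type*} [Ring R] [Algebra ℂ R] {m k : ℕ}
    (Q : Fin m → Fin m → ℂ) (row : Fin k → Fin m)
    (S : Finset (Fin k)) (b : Fin k → Fin k → R) : R :=
  ∑ J ∈ Finset.univ.filter (fun J : Finset (Fin k) => ∀ x, x ∉ S → x ∈ J),
    ∑ σ ∈ Finset.univ.filter (fun σ : Equiv.Perm (Fin k) => ∀ x, x ∉ J → σ x = x),
      (((-1 : ℂ) ^ J.card *
        ∏ p ∈ Finset.univ.filter
          (fun p : Fin k × Fin k =>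
            p.1 ∈ J ∧ p.2 ∈ J ∧ p.1 < p.2 ∧ σ p.2 < σ p.1),
          (-(Q (row (σ p.2)) (row (σ p.1)))⁻¹)) •
        ((J.sort (· ≤ ·)).map (fun c => b (σ c) c)).prod)

/-- The sign-and-weight of moving the generator `e i` into sorted position among the
generators indexed by `S` in the `𝐪`-exterior algebra. -/
def qExtWeight {ι : Type*} [LinearOrder ι] (Q : ι → ι → ℂ) (S : Finset ι) (i : ι) : ℂ :=
  ∏ s ∈ S with i < s, -Q s i

/-- Right multiplication by the column vector `∑ i, a i c • e i` in the `𝐪`-exterior algebra,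
in coordinates with respect to the sorted monomials. -/
def qExtMul {ι R : Type*} [LinearOrder ι] [Ring R] [Algebra ℂ R] (Q : ι → ι → ℂ)
    (a : ι → ι → R) (c : ι) (f : Finset ι → R) (S : Finset ι) : R :=
  ∑ i ∈ S, qExtWeight Q S i • (f (S.erase i) * a i c)

/-- The `𝐪`-minor of `a` with columns `K` and rows `S`. -/
noncomputable def qMinor {ι R : Type*} [LinearOrder ι] [Fintype ι] [Ring R] [Algebra ℂ R]
    (Q : ι → ι → ℂ) (a : ι → ι → R) (K S : Finset ι) : R :=
  open Classical in
  ∑ g : ι → ι with (∀ x, x ∉ K → g x = x) ∧ Set.BijOn g K S,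
    (∏ p : ι × ι with p.1 ∈ K ∧ p.2 ∈ K ∧ p.1 < p.2 ∧ g p.2 < g p.1,
      (-(Q (g p.2) (g p.1))⁻¹)) •
      ((K.sort (· ≤ ·)).map (fun c => a (g c) c)).prod

section

variable {ι R : Type*} [LinearOrder ι] [Ring R] [Algebra ℂ R]
  {Q : ι → ι → ℂ} {a : ι → ι → R}

theorem qExtMul_smul (c : ι) (z : ℂ) (f : Finset ι → R) :
    qExtMul Q a c (z • f) = z • qExtMul Q a c f := by
  funext S
  simp only [qExtMul, Pi.smul_apply, Finset.smul_sum, smul_mul_assoc]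
  exact Finset.sum_congr rfl fun i _ => smul_comm _ _ _

theorem qExtMul_zero (c : ι) : qExtMul Q a c (0 : Finset ι → R) = 0 := by
  funext S
  simp [qExtMul]

theorem qExtWeight_erase_of_lt {S : Finset ι} {i j : ι} (hij : i < j) :
    qExtWeight Q (S.erase i) j = qExtWeight Q S j := by
  unfold qExtWeight
  congr 1
  ext x
  simp only [Finset.mem_filter, Finset.mem_erase]
  refine ⟨fun h => ⟨h.1.2, h.2⟩, fun h => ⟨⟨(hij.trans h.2).ne', h.1⟩, h.2⟩⟩

theorem qExtWeight_eq_mul_erase {S : Finset ι} {i j : ι} (hij : i < j) (hj : j ∈ S) :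
    qExtWeight Q S i = -Q j i * qExtWeight Q (S.erase j) i := by
  unfold qExtWeight
  rw [Finset.filter_erase, Finset.mul_prod_erase _ (fun s => -Q s i)]
  simp [hj, hij]

theorem qExtWeight_mul_swap (hQ0 : ∀ i j, Q i j ≠ 0) (hQ2 : ∀ i j, Q j i = (Q i j)⁻¹)
    {S : Finset ι} {i j : ι} (hi : i ∈ S) (hj : j ∈ S) (hij : i ≠ j) :
    qExtWeight Q S i * qExtWeight Q (S.erase i) j =
      -Q j i * (qExtWeight Q S j * qExtWeight Q (S.erase j) i) := by
  rcases hij.lt_or_gt with h | h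
  · rw [qExtWeight_erase_of_lt h, qExtWeight_eq_mul_erase h hj]
    ring
  · rw [qExtWeight_erase_of_lt h, qExtWeight_eq_mul_erase h hi, hQ2 i j]
    field_simp [hQ0 i j]

/-- Column vectors satisfying the `𝐪`-right-quantum relation `𝐪`-anticommute. -/
theorem qExtMul_swap (hQ0 : ∀ i j, Q i j ≠ 0) (hQ2 : ∀ i j, Q j i = (Q i j)⁻¹) {k l : ι}
    (h : ∀ i j, i ≠ j → a i k * a j l + Q k l • (a i l * a j k) =
      Q j i • (a j k * a i l + Q k l • (a j l * a i k))) (f : Finset ι → R) :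
    qExtMul Q a l (qExtMul Q a k f) = (-Q k l) • qExtMul Q a k (qExtMul Q a l f) := by
  funext S
  have expand : ∀ k l, qExtMul Q a l (qExtMul Q a k f) S =
      ∑ j ∈ S, ∑ i ∈ S.erase j, (qExtWeight Q S j * qExtWeight Q (S.erase j) i) •
        (f ((S.erase j).erase i) * (a i k * a j l)) := by
    intro k l
    simp only [qExtMul, Finset.sum_mul, Finset.smul_sum, smul_mul_assoc, smul_smul, mul_assoc]
  rw [Pi.smul_apply, neg_smul, eq_neg_iff_add_eq_zero, expand, expand]
  simp only [Finset.smul_sum, ← Finset.sum_add_distrib]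
  set H : ι → ι → R := fun j i =>
    (qExtWeight Q S j * qExtWeight Q (S.erase j) i) •
        (f ((S.erase j).erase i) * (a i k * a j l)) +
      Q k l • (qExtWeight Q S j * qExtWeight Q (S.erase j) i) •
        (f ((S.erase j).erase i) * (a i l * a j k)) with hH
  change ∑ j ∈ S, ∑ i ∈ S.erase j, H j i = 0
  have hswap : ∑ j ∈ S, ∑ i ∈ S.erase j, H j i = ∑ j ∈ S, ∑ i ∈ S.erase j, H i j := by
    refine Finset.sum_comm' fun x y => ?_
    simp only [Finset.mem_erase]
    tauto
  have hneg : ∑ j ∈ S, ∑ i ∈ S.erase j, H j i = -∑ j ∈ S, ∑ i ∈ S.erase j, H i j := by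
    rw [← Finset.sum_neg_distrib]
    refine Finset.sum_congr rfl fun j hj => ?_
    rw [← Finset.sum_neg_distrib]
    refine Finset.sum_congr rfl fun i hi => ?_
    obtain ⟨hij, hi⟩ := Finset.mem_erase.mp hi
    have e1 : ∀ u : ℂ, ∀ x y z : R, u • (x * y) + Q k l • u • (x * z) =
        u • (x * (y + Q k l • z)) := by
      intro u x y z
      rw [mul_add, smul_add, mul_smul_comm, smul_comm]
    simp only [hH, e1]
    rw [qExtWeight_mul_swap hQ0 hQ2 hi hj hij, h i j hij, Finset.erase_right_comm, mul_smul_comm,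
      smul_smul, ← neg_smul]
    congr 1
    ring
  rw [← hswap] at hneg
  have h2 : (2 : ℂ) • ∑ j ∈ S, ∑ i ∈ S.erase j, H j i = 0 := by
    rw [two_smul]
    nth_rewrite 1 [hneg]
    exact neg_add_cancel _
  simpa using h2

theorem Finset.sort_insert_of_lt {K : Finset ι} {c : ι} (hc : ∀ x ∈ K, x < c) :
    (insert c K).sort (· ≤ ·) = K.sort (· ≤ ·) ++ [c] := by
  have hcK : c ∉ K := fun h => (hc c h).false
  refine List.Perm.eq_of_pairwise (le := (· ≤ ·)) (fun _ _ _ _ => le_antisymm)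
    (Finset.pairwise_sort _ _) ?_ ?_
  · rw [List.pairwise_append]
    refine ⟨Finset.pairwise_sort _ _, List.pairwise_singleton _ _, fun x hx y hy => ?_⟩
    rw [List.mem_singleton.mp hy]
    exact (hc x ((Finset.mem_sort _).mp hx)).le
  · rw [← Multiset.coe_eq_coe, Finset.sort_eq, ← Multiset.coe_add, Finset.sort_eq,
      Finset.insert_val_of_notMem hcK, Multiset.coe_singleton, add_comm, Multiset.singleton_add]

variable [Fintype ι]

theorem qMinor_empty (S : Finset ι) : qMinor Q a ∅ S = if S = ∅ then 1 else 0 := by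
  classical
  unfold qMinor
  split_ifs with hS
  · subst hS
    rw [Finset.sum_eq_single id]
    · simp
    · intro g hg hne
      exact absurd (funext fun x => (Finset.mem_filter.mp hg).2.1 x (by simp)) hne
    · intro h
      simp at h
  · refine Finset.sum_eq_zero fun g hg => absurd ?_ hS
    have := (Finset.mem_filter.mp hg).2.2.image_eq
    simpa [eq_comm (a := (∅ : Set ι))] using this

/-- Laplace expansion of a `𝐪`-minor along its last column. -/
theorem qMinor_insert (hQ2 : ∀ i j, Q j i = (Q i j)⁻¹) {K : Finset ι} {c : ι}
    (hc : ∀ x ∈ K, x < c) :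
    qMinor Q a (insert c K) = qExtMul Q a c (qMinor Q a K) := by
  classical
  have hcK : c ∉ K := fun h => (hc c h).false
  have hne : ∀ x ∈ K, x ≠ c := fun x hx h => hcK (h ▸ hx)
  funext S
  simp only [qMinor, qExtMul, Finset.sum_mul, Finset.smul_sum]
  rw [Finset.sum_sigma']
  symm
  refine Finset.sum_bij' (fun p _ => Function.update p.2 c p.1)
    (fun g _ => ⟨g c, Function.update g c c⟩) ?_ ?_ ?_ ?_ ?_
  · rintro ⟨i, g⟩ hp
    simp only [Finset.mem_sigma, Finset.mem_filter, Finset.mem_univ, true_and] at hp ⊢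
    obtain ⟨hi, hfix, hbij⟩ := hp
    refine ⟨fun x hx => ?_, ?_⟩
    · rw [Finset.mem_insert, not_or] at hx
      rw [Function.update_of_ne hx.1, hfix x hx.2]
    · have hb : Set.BijOn (Function.update g c i) K (S.erase i) :=
        hbij.congr fun x hx => (Function.update_of_ne (hne x hx) _ _).symm
      have := hb.insert (a := c) (by simp)
      simpa [Finset.insert_erase hi, Set.insert_eq_of_mem, hi] using this
  · intro g hg
    simp only [Finset.mem_sigma, Finset.mem_filter, Finset.mem_univ, true_and] at hg ⊢
    obtain ⟨hfix, hbij⟩ := hg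
    refine ⟨hbij.mapsTo (by simp), fun x hx => ?_, ?_⟩
    · by_cases hxc : x = c
      · simp [hxc]
      · rw [Function.update_of_ne hxc, hfix x (by simp [hxc, hx])]
    · have hb : Set.BijOn g K (S.erase (g c)) := by
        have := hbij.sdiff_singleton (a := c) (by simp)
        simpa [Set.insert_sdiff_of_mem, hcK] using this
      exact hb.congr fun x hx => (Function.update_of_ne (hne x hx) _ _).symm
  · rintro ⟨i, g⟩ hp
    simp only [Finset.mem_sigma, Finset.mem_filter, Finset.mem_univ, true_and] at hp
    have : Function.update g c c = g := by
      conv_rhs => rw [← Function.update_eq_self c g, hp.2.1 c hcK]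
    simp [this]
  · intro g _
    simp
  · rintro ⟨i, g⟩ hp
    simp only [Finset.mem_sigma, Finset.mem_filter, Finset.mem_univ, true_and] at hp
    obtain ⟨hi, hfix, hbij⟩ := hp
    have hlist : (((insert c K).sort (· ≤ ·)).map
        (fun x => a (Function.update g c i x) x)).prod =
        ((K.sort (· ≤ ·)).map (fun x => a (g x) x)).prod * a i c := by
      rw [Finset.sort_insert_of_lt hc, List.map_append, List.prod_append]
      simp only [List.map_cons, List.map_nil, List.prod_singleton, Function.update_self]
      congr 2
      refine List.map_congr_left fun x hx => ?_
      rw [Function.update_of_ne (hne x ((Finset.mem_sort _).mp hx))]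
    have hweight : (∏ p : ι × ι with p.1 ∈ insert c K ∧ p.2 ∈ insert c K ∧ p.1 < p.2 ∧
          Function.update g c i p.2 < Function.update g c i p.1,
          (-(Q (Function.update g c i p.2) (Function.update g c i p.1))⁻¹)) =
        qExtWeight Q S i * ∏ p : ι × ι with p.1 ∈ K ∧ p.2 ∈ K ∧ p.1 < p.2 ∧ g p.2 < g p.1,
          (-(Q (g p.2) (g p.1))⁻¹) := by
      rw [← Finset.prod_filter_mul_prod_filter_not _ (fun p : ι × ι => p.2 = c)]
      congr 1
      · unfold qExtWeight
        symm
        have himg : (S.filter (i < ·)) = (K.filter (fun x => i < g x)).image g := by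
          ext s
          simp only [Finset.mem_filter, Finset.mem_image]
          constructor
          · rintro ⟨hs, his⟩
            obtain ⟨x, hx, rfl⟩ := hbij.surjOn (show s ∈ (S.erase i : Finset ι) from
              Finset.mem_erase.mpr ⟨his.ne', hs⟩)
            exact ⟨x, ⟨hx, his⟩, rfl⟩
          · rintro ⟨x, ⟨hx, hix⟩, rfl⟩
            exact ⟨Finset.mem_of_mem_erase (hbij.mapsTo hx), hix⟩
        rw [himg, Finset.prod_image fun x hx y hy =>
          hbij.injOn (Finset.mem_filter.mp hx).1 (Finset.mem_filter.mp hy).1]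
        refine Finset.prod_bij' (fun x _ => (x, c)) (fun p _ => p.1) ?_ ?_ ?_ ?_ ?_
        · intro x hx
          obtain ⟨hx, hix⟩ := Finset.mem_filter.mp hx
          simp [hx, hc x hx, Function.update_of_ne (hne x hx), hix]
        · rintro ⟨x, y⟩ hp
          simp only [Finset.mem_filter, Finset.mem_univ, true_and, Finset.mem_insert] at hp ⊢
          obtain ⟨⟨hx, -, hxy, hlt⟩, rfl⟩ := hp
          have hx' := hx.resolve_left hxy.ne
          rw [Function.update_self, Function.update_of_ne hxy.ne] at hlt
          exact ⟨hx', hlt⟩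
        · simp
        · rintro ⟨x, y⟩ hp
          simp only [Finset.mem_filter] at hp
          simp [hp.2]
        · intro x hx
          obtain ⟨hx, hix⟩ := Finset.mem_filter.mp hx
          simp only [Function.update_self, Function.update_of_ne (hne x hx)]
          rw [hQ2]
      · rw [Finset.filter_filter]
        have key : ∀ p : ι × ι, (((p.1 ∈ insert c K ∧ p.2 ∈ insert c K ∧ p.1 < p.2 ∧
            Function.update g c i p.2 < Function.update g c i p.1) ∧ ¬p.2 = c) ↔
            (p.1 ∈ K ∧ p.2 ∈ K ∧ p.1 < p.2 ∧ g p.2 < g p.1)) := by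
          rintro ⟨x, y⟩
          simp only [Finset.mem_insert]
          constructor
          · rintro ⟨⟨hx, hy, hxy, hlt⟩, hyc⟩
            have hy' := hy.resolve_left hyc
            have hxc : x ≠ c := (hxy.trans (hc y hy')).ne
            rw [Function.update_of_ne hxc, Function.update_of_ne hyc] at hlt
            exact ⟨hx.resolve_left hxc, hy', hxy, hlt⟩
          · rintro ⟨hx, hy, hxy, hlt⟩
            rw [Function.update_of_ne (hne x hx), Function.update_of_ne (hne y hy)]
            exact ⟨⟨Or.inr hx, Or.inr hy, hxy, hlt⟩, hne y hy⟩
        refine Finset.prod_congr (Finset.filter_congr fun p _ => key p) fun p hp => ?_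
        obtain ⟨-, hx, hy, -⟩ := Finset.mem_filter.mp hp
        rw [Function.update_of_ne (hne _ hx), Function.update_of_ne (hne _ hy)]
    rw [hlist, hweight, smul_mul_assoc, smul_smul]

theorem qExtMul_qMinor_of_mem (hQ0 : ∀ i j, Q i j ≠ 0) (hQ1 : ∀ i, Q i i = 1)
    (hQ2 : ∀ i j, Q j i = (Q i j)⁻¹) {U : Set ι}
    (h : ∀ k ∈ U, ∀ l ∈ U, ∀ i j, i ≠ j → a i k * a j l + Q k l • (a i l * a j k) =
      Q j i • (a j k * a i l + Q k l • (a j l * a i k)))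
    {l : ι} (K : Finset ι) (hK : ∀ x ∈ K, x ∈ U) (hl : l ∈ K) :
    qExtMul Q a l (qMinor Q a K) = 0 := by
  induction K using Finset.induction_on_max with
  | empty => simp at hl
  | insert c K hc ih =>
    rw [qMinor_insert hQ2 hc]
    have hcU := hK c (by simp)
    by_cases hlc : l = c
    · subst hlc
      have h1 := qExtMul_swap hQ0 hQ2 (h l hcU l hcU) (qMinor Q a K)
      rw [hQ1, neg_smul, one_smul, eq_neg_iff_add_eq_zero, ← two_smul ℂ] at h1
      simpa using h1
    · have hlK : l ∈ K := (Finset.mem_insert.mp hl).resolve_left hlc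
      rw [qExtMul_swap hQ0 hQ2 (h c hcU l (hK l hl)),
        ih (fun x hx => hK x (Finset.mem_insert_of_mem hx)) hlK, qExtMul_zero, smul_zero]

theorem qExtMul_qMinor_of_notMem (hQ0 : ∀ i j, Q i j ≠ 0)
    (hQ2 : ∀ i j, Q j i = (Q i j)⁻¹) {U : Set ι}
    (h : ∀ k ∈ U, ∀ l ∈ U, ∀ i j, i ≠ j → a i k * a j l + Q k l • (a i l * a j k) =
      Q j i • (a j k * a i l + Q k l • (a j l * a i k)))
    {l : ι} (hlU : l ∈ U) (K : Finset ι) (hK : ∀ x ∈ K, x ∈ U) (hl : l ∉ K) :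
    qExtMul Q a l (qMinor Q a K) = qExtWeight Q K l • qMinor Q a (insert l K) := by
  induction K using Finset.induction_on_max with
  | empty =>
    rw [qMinor_insert hQ2 (by simp)]
    simp [qExtWeight]
  | insert c K hc ih =>
    have hlc : l ≠ c := fun e => hl (by simp [e])
    have hcK : c ∉ K := fun h => (hc c h).false
    rcases hlc.lt_or_gt with hlt | hgt
    · have hlK : l ∉ K := fun e => hl (by simp [e])
      rw [qMinor_insert hQ2 hc, qExtMul_swap hQ0 hQ2 (h c (hK c (by simp)) l hlU),
        ih (fun x hx => hK x (Finset.mem_insert_of_mem hx)) hlK, qExtMul_smul, smul_smul,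
        Finset.insert_comm, qMinor_insert hQ2 (K := insert l K),
        qExtWeight_eq_mul_erase hlt (Finset.mem_insert_self c K), Finset.erase_insert hcK]
      intro x hx
      rcases Finset.mem_insert.mp hx with rfl | hx
      exacts [hlt, hc x hx]
    · have hmax : ∀ x ∈ insert c K, x < l := by
        intro x hx
        rcases Finset.mem_insert.mp hx with rfl | hx
        exacts [hgt, (hc x hx).trans hgt]
      have : qExtWeight Q (insert c K) l = 1 := by
        unfold qExtWeight
        rw [Finset.filter_false_of_mem fun x hx => (hmax x hx).not_gt, Finset.prod_empty]
      rw [this, one_smul, qMinor_insert hQ2 hmax]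

end

theorem qExtMul_map {ι κ R : Type*} [LinearOrder ι] [LinearOrder κ] [Ring R] [Algebra ℂ R]
    (e : κ ↪o ι) (Q : ι → ι → ℂ) (a : ι → ι → R) (c : κ) (f : Finset ι → R)
    (S : Finset κ) :
    qExtMul Q a (e c) f (S.map e.toEmbedding) =
      qExtMul (fun i j => Q (e i) (e j)) (fun i j => a (e i) (e j)) c
        (fun T => f (T.map e.toEmbedding)) S := by
  unfold qExtMul
  rw [Finset.sum_map]
  refine Finset.sum_congr rfl fun i _ => ?_
  have hw : qExtWeight Q (S.map e.toEmbedding) (e.toEmbedding i) =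
      qExtWeight (fun i j => Q (e i) (e j)) S i := by
    unfold qExtWeight
    rw [Finset.filter_map, Finset.prod_map]
    simp
  rw [hw, ← Finset.map_erase]
  rfl

theorem qMinor_map {ι κ R : Type*} [LinearOrder ι] [LinearOrder κ] [Fintype ι] [Fintype κ]
    [Ring R] [Algebra ℂ R] (e : κ ↪o ι) {Q : ι → ι → ℂ} (hQ2 : ∀ i j, Q j i = (Q i j)⁻¹)
    (a : ι → ι → R) (K S : Finset κ) :
    qMinor Q a (K.map e.toEmbedding) (S.map e.toEmbedding) =
      qMinor (fun i j => Q (e i) (e j)) (fun i j => a (e i) (e j)) K S := by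
  induction K using Finset.induction_on_max generalizing S with
  | empty => simp [qMinor_empty]
  | insert c K hc ih =>
    rw [Finset.map_insert, qMinor_insert hQ2, qMinor_insert (fun i j => hQ2 _ _) hc]
    · exact (qExtMul_map e Q a c _ S).trans (by simp only [ih])
    · intro x hx
      obtain ⟨y, hy, rfl⟩ := Finset.mem_map.mp hx
      exact e.lt_iff_lt.mpr (hc y hy)

theorem qdetDQ_univ_eq_sum_qMinor {R : Type*} [Ring R] [Algebra ℂ R] {m k : ℕ}
    (Q : Fin m → Fin m → ℂ) (row : Fin k ↪o Fin m) (b : Fin k → Fin k → R) :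
    qdetDQ Q row Finset.univ b =
      ∑ J : Finset (Fin k), (-1 : ℂ) ^ J.card •
        qMinor (fun i j => Q (row i) (row j)) b J J := by
  classical
  unfold qdetDQ qMinor
  rw [Finset.filter_true_of_mem (by simp)]
  refine Finset.sum_congr rfl fun J _ => ?_
  rw [Finset.smul_sum]
  refine Finset.sum_nbij (fun σ => ⇑σ) ?_ ?_ ?_ ?_
  · intro σ hσ
    simp only [Finset.mem_filter, Finset.mem_univ, true_and] at hσ ⊢
    refine ⟨hσ, ?_⟩
    have hmaps : Set.MapsTo σ J J := by
      intro x hx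
      by_contra hσx
      exact hσx ((σ.injective (hσ _ hσx)).symm ▸ hx)
    refine ⟨hmaps, σ.injective.injOn, fun y hy => ⟨σ.symm y, ?_, by simp⟩⟩
    by_contra hx
    have := hσ _ hx
    rw [σ.apply_symm_apply] at this
    exact hx (this ▸ hy)
  · exact fun σ _ τ _ h => DFunLike.coe_injective h
  · intro g hg
    simp only [Finset.coe_filter, Finset.mem_univ, true_and, Set.mem_ofPred_eq] at hg
    obtain ⟨hfix, hbij⟩ := hg
    have hsurj : Function.Surjective g := by
      intro y
      by_cases hy : y ∈ J
      · obtain ⟨x, -, hx⟩ := hbij.surjOn hy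
        exact ⟨x, hx⟩
      · exact ⟨y, hfix y hy⟩
    refine ⟨Equiv.ofBijective g (Finite.injective_iff_bijective.mp
      (Finite.injective_iff_surjective.mpr hsurj)), ?_, rfl⟩
    simpa using hfix
  · intro σ _
    rw [smul_smul]

/-- The last row of the adjugate of `1 - A`, up to a rescaling of its entries. -/
noncomputable def qAdjLast {ι R : Type*} [LinearOrder ι] [Fintype ι] [Ring R] [Algebra ℂ R]
    (Q : ι → ι → ℂ) (a : ι → ι → R) (L i : ι) : R :=
  ∑ K : Finset ι with L ∉ K, if i ∈ insert L K then
    ((-1 : ℂ) ^ K.card * qExtWeight Q (insert L K) i) •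
      qMinor Q a K ((insert L K).erase i) else 0

section

variable {ι R : Type*} [LinearOrder ι] [Fintype ι] [Ring R] [Algebra ℂ R]
  {Q : ι → ι → ℂ} {a : ι → ι → R} {L : ι}

theorem sum_qAdjLast_mul (l : ι) :
    ∑ i, qAdjLast Q a L i * a i l =
      ∑ K : Finset ι with L ∉ K,
        (-1 : ℂ) ^ K.card • qExtMul Q a l (qMinor Q a K) (insert L K) := by
  simp only [qAdjLast, Finset.sum_mul]
  rw [Finset.sum_comm]
  refine Finset.sum_congr rfl fun K _ => ?_
  simp only [ite_mul, zero_mul, qExtMul, Finset.smul_sum]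
  rw [Finset.sum_ite_mem, Finset.univ_inter]
  refine Finset.sum_congr rfl fun i _ => ?_
  rw [smul_mul_assoc, smul_smul]

theorem qAdjLast_self (hL : ∀ x, x ≤ L) :
    qAdjLast Q a L L = ∑ K : Finset ι with L ∉ K, (-1 : ℂ) ^ K.card • qMinor Q a K K := by
  refine Finset.sum_congr rfl fun K hK => ?_
  have hLK : L ∉ K := (Finset.mem_filter.mp hK).2
  have hw : qExtWeight Q (insert L K) L = 1 := by
    unfold qExtWeight
    rw [Finset.filter_false_of_mem fun x _ => (hL x).not_gt, Finset.prod_empty]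
  simp [hw, Finset.erase_insert hLK]

theorem Finset.sum_filter_eq_sum_notMem_add_sum_insert {M : Type*} [AddCommMonoid M]
    (l : ι) (p : Finset ι → Prop)
    [DecidablePred p] (hp : ∀ K, l ∉ K → (p (insert l K) ↔ p K)) (f : Finset ι → M) :
    ∑ K : Finset ι with p K, f K =
      ∑ K : Finset ι with p K ∧ l ∉ K, f K +
        ∑ K : Finset ι with p K ∧ l ∉ K, f (insert l K) := by
  rw [← Finset.sum_filter_add_sum_filter_not _ (fun K : Finset ι => l ∉ K),
    Finset.filter_filter]
  congr 1
  refine Finset.sum_bij' (fun K _ => K.erase l) (fun K _ => insert l K) ?_ ?_ ?_ ?_ ?_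
  · intro K hK
    simp only [Finset.mem_filter, Finset.mem_univ, true_and, not_not] at hK ⊢
    refine ⟨?_, Finset.notMem_erase _ _⟩
    rw [← hp _ (Finset.notMem_erase _ _), Finset.insert_erase hK.2]
    exact hK.1
  · intro K hK
    simp only [Finset.mem_filter, Finset.mem_univ, true_and, not_not] at hK ⊢
    exact ⟨(hp K hK.2).mpr hK.1, Finset.mem_insert_self _ _⟩
  · intro K hK
    exact Finset.insert_erase (not_not.mp (Finset.mem_filter.mp hK).2)
  · intro K hK
    exact Finset.erase_insert (Finset.mem_filter.mp hK).2.2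
  · intro K hK
    rw [Finset.insert_erase (not_not.mp (Finset.mem_filter.mp hK).2)]

theorem sum_qMinor_eq_sub (hQ2 : ∀ i j, Q j i = (Q i j)⁻¹) (hL : ∀ x, x ≤ L) :
    ∑ J : Finset ι, (-1 : ℂ) ^ J.card • qMinor Q a J J =
      qAdjLast Q a L L - ∑ i, qAdjLast Q a L i * a i L := by
  have h := Finset.sum_filter_eq_sum_notMem_add_sum_insert L (fun _ => True) (fun _ _ => Iff.rfl)
    fun J : Finset ι => (-1 : ℂ) ^ J.card • qMinor Q a J J
  simp only [true_and, Finset.filter_true] at h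
  rw [h, qAdjLast_self hL, sum_qAdjLast_mul, sub_eq_add_neg, ← Finset.sum_neg_distrib]
  congr 1
  refine Finset.sum_congr rfl fun K hK => ?_
  have hLK : L ∉ K := (Finset.mem_filter.mp hK).2
  rw [Finset.card_insert_of_notMem hLK, qMinor_insert hQ2 fun x hx =>
    lt_of_le_of_ne (hL x) fun e => hLK (e ▸ hx), pow_succ, mul_neg_one, neg_smul]

theorem sum_qAdjLast_mul_of_ne (hQ0 : ∀ i j, Q i j ≠ 0) (hQ1 : ∀ i, Q i i = 1)
    (hQ2 : ∀ i j, Q j i = (Q i j)⁻¹) (hL : ∀ x, x ≤ L)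
    (h : ∀ k, k ≠ L → ∀ l, l ≠ L → ∀ i j, i ≠ j →
      a i k * a j l + Q k l • (a i l * a j k) =
        Q j i • (a j k * a i l + Q k l • (a j l * a i k))) {l : ι} (hl : l ≠ L) :
    ∑ i, qAdjLast Q a L i * a i l = Q l L • qAdjLast Q a L l := by
  have hlL : l < L := lt_of_le_of_ne (hL l) hl
  have hp : ∀ K : Finset ι, l ∉ K → (L ∉ insert l K ↔ L ∉ K) := by
    intro K _
    simp [hl.symm]
  rw [sum_qAdjLast_mul, qAdjLast, Finset.sum_filter_eq_sum_notMem_add_sum_insert l (L ∉ ·) hp,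
    Finset.sum_filter_eq_sum_notMem_add_sum_insert l (L ∉ ·) hp]
  have hU : ∀ K : Finset ι, L ∉ K → ∀ x ∈ K, x ∈ {x | x ≠ L} :=
    fun K hK x hx e => hK (e ▸ hx)
  have h0 : ∑ K : Finset ι with L ∉ K ∧ l ∉ K, (-1 : ℂ) ^ (insert l K).card •
      qExtMul Q a l (qMinor Q a (insert l K)) (insert L (insert l K)) = 0 := by
    refine Finset.sum_eq_zero fun K hK => ?_
    obtain ⟨hLK, hlK⟩ := (Finset.mem_filter.mp hK).2
    rw [qExtMul_qMinor_of_mem hQ0 hQ1 hQ2 (U := {x | x ≠ L}) h _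
      (hU _ ((hp K hlK).mpr hLK)) (Finset.mem_insert_self l K), Pi.zero_apply, smul_zero]
  have h1 : ∑ K : Finset ι with L ∉ K ∧ l ∉ K, (if l ∈ insert L K then
      ((-1 : ℂ) ^ K.card * qExtWeight Q (insert L K) l) •
        qMinor Q a K ((insert L K).erase l) else 0) = 0 := by
    refine Finset.sum_eq_zero fun K hK => ?_
    rw [if_neg]
    simpa [hl] using (Finset.mem_filter.mp hK).2.2
  rw [h0, h1, add_zero, zero_add, Finset.smul_sum]
  refine Finset.sum_congr rfl fun K hK => ?_
  obtain ⟨hLK, hlK⟩ := (Finset.mem_filter.mp hK).2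
  have hw : qExtWeight Q (insert L (insert l K)) l = -Q L l * qExtWeight Q K l := by
    rw [qExtWeight_eq_mul_erase hlL (Finset.mem_insert_self _ _),
      Finset.erase_insert ((hp K hlK).mpr hLK)]
    congr 1
    unfold qExtWeight
    rw [Finset.filter_insert, if_neg (lt_irrefl l)]
  rw [qExtMul_qMinor_of_notMem hQ0 hQ2 (U := {x | x ≠ L}) h hl K (hU K hLK) hlK,
    if_pos (by simp), hw, Finset.card_insert_of_notMem hlK, Finset.insert_comm,
    Finset.erase_insert (by simp [hl, hlK]), Pi.smul_apply, smul_smul, smul_smul, hQ2 l L]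
  congr 1
  field_simp [hQ0 l L]
  ring

/-- Cramer's rule for the corner entry of the inverse of the row-rescaled matrix `1 - A`. -/
theorem qAdjLast_self_eq_mul (hQ0 : ∀ i j, Q i j ≠ 0) (hQ1 : ∀ i, Q i i = 1)
    (hQ2 : ∀ i j, Q j i = (Q i j)⁻¹) (hL : ∀ x, x ≤ L)
    (h : ∀ k, k ≠ L → ∀ l, l ≠ L → ∀ i j, i ≠ j →
      a i k * a j l + Q k l • (a i l * a j k) =
        Q j i • (a j k * a i l + Q k l • (a j l * a i k)))
    {X : Matrix ι ι R} (hX : (1 - Matrix.of fun k l => (Q k L)⁻¹ • a k l) * X = 1) :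
    qAdjLast Q a L L =
      (∑ J : Finset ι, (-1 : ℂ) ^ J.card • qMinor Q a J J) * X L L := by
  set C : ι → R := fun i => Q i L • qAdjLast Q a L i
  have hC : Matrix.vecMul C (1 - Matrix.of fun k l => (Q k L)⁻¹ • a k l) =
      Pi.single L (∑ J : Finset ι, (-1 : ℂ) ^ J.card • qMinor Q a J J) := by
    rw [Matrix.vecMul_sub, Matrix.vecMul_one]
    funext l
    have hs : Matrix.vecMul C (Matrix.of fun k l => (Q k L)⁻¹ • a k l) l =
        ∑ i, qAdjLast Q a L i * a i l := by
      simp only [Matrix.vecMul, dotProduct, Matrix.of_apply, C]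
      refine Finset.sum_congr rfl fun i _ => ?_
      rw [smul_mul_smul_comm, mul_inv_cancel₀ (hQ0 i L), one_smul]
    rw [Pi.sub_apply, hs]
    by_cases hl : l = L
    · subst hl
      rw [Pi.single_eq_same, sum_qMinor_eq_sub hQ2 hL]
      simp [C, hQ1]
    · rw [Pi.single_eq_of_ne hl, sum_qAdjLast_mul_of_ne hQ0 hQ1 hQ2 hL h hl, sub_self]
  have h2 := congrFun (congrArg (fun v => Matrix.vecMul v X) hC) L
  simp only [Matrix.vecMul_vecMul, hX, Matrix.vecMul_one] at h2
  simpa [C, hQ1] using h2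

end

/-- Both the `𝐪`-Cartier–Foata and the `𝐪`-right-quantum relations yield the index-symmetric
form of the `𝐪`-right-quantum relations. -/
theorem qRightQuantum_symm {ι R : Type*} [LinearOrder ι] [Ring R] [Algebra ℂ R]
    {Q : ι → ι → ℂ} (hQ0 : ∀ i j, Q i j ≠ 0) (hQ1 : ∀ i, Q i i = 1)
    (hQ2 : ∀ i j, Q j i = (Q i j)⁻¹) {a : ι → ι → R} {U : ι → Prop}
    (hrel :
      (∀ i j k l : ι, i ≠ j → U k → U l →
        (Q k l) • (a j l * a i k) = (Q i j) • (a i k * a j l)) ∨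
      ((∀ i j k : ι, i < j → U k →
          a j k * a i k = (Q i j) • (a i k * a j k)) ∧
        (∀ i j k l : ι, i < j → k < l → U k → U l →
          a i k * a j l - (Q i j)⁻¹ • (a j k * a i l) =
            (Q k l * (Q i j)⁻¹) • (a j l * a i k) - (Q k l) • (a i l * a j k))))
    {k l : ι} (hk : U k) (hl : U l) {i j : ι} (hij : i ≠ j) :
    a i k * a j l + Q k l • (a i l * a j k) =
      Q j i • (a j k * a i l + Q k l • (a j l * a i k)) := by
  rcases hrel with h | ⟨h1, h2⟩
  · have e1 := h i j k l hij hk hl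
    have e2 := h j i k l hij.symm hk hl
    rw [e2, smul_add, e1, smul_smul, hQ2 i j, inv_mul_cancel₀ (hQ0 i j), one_smul, add_comm]
  · have key : ∀ i j, i < j → ∀ k l, k < l → U k → U l →
        a i k * a j l + Q k l • (a i l * a j k) =
          Q j i • (a j k * a i l + Q k l • (a j l * a i k)) := by
      intro i j hij k l hkl hk hl
      have := h2 i j k l hij hkl hk hl
      rw [hQ2 i j, smul_add, smul_smul, mul_comm _ (Q k l)]
      rw [sub_eq_sub_iff_add_eq_add] at this
      rw [this, add_comm]
    have row : ∀ i j, i < j → a i k * a j l + Q k l • (a i l * a j k) =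
        Q j i • (a j k * a i l + Q k l • (a j l * a i k)) := by
      intro i j hij
      rcases lt_trichotomy k l with hkl | rfl | hkl
      · exact key i j hij k l hkl hk hl
      · rw [hQ1, one_smul, one_smul, h1 i j k hij hk, ← smul_add, smul_smul, hQ2 i j,
          inv_mul_cancel₀ (hQ0 i j), one_smul]
      · have := key i j hij l k hkl hl hk
        have h3 := congrArg (Q k l • ·) this
        simp only [smul_add, smul_smul, hQ2 k l, mul_inv_cancel₀ (hQ0 k l), one_smul,
          mul_left_comm (Q k l), mul_one] at h3 ⊢
        rw [add_comm, h3, add_comm, mul_comm (Q k l)]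
    rcases hij.lt_or_gt with hij | hij
    · exact row i j hij
    · rw [row j i hij, smul_smul, hQ2 i j, inv_mul_cancel₀ (hQ0 i j), one_smul]

/-- If only the first `m - 1` columns of the `m × m` matrix `A` satisfy the
`𝐪`-Cartier–Foata (or `𝐪`-right-quantum) relations, then still
`((I - A_{[mm]})⁻¹)_{mm} = det_𝐪(I - A)⁻¹ · det_𝐪(I - A^{mm})`, where `A^{mm}` is `A`
with the last row and column removed, `A_{[mm]}` is `A` with entry `a_{kl}` rescaled by
`q_{km}⁻¹` for `k < m`, and the inverses are hypothesized two-sided inverses (as they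
are in the completed algebra).  (Here the matrix has size `m + 1` in Lean, with last
index `Fin.last m`.) -/
theorem q_sylvester_weak_column_condition {R : Type*} [Ring R] [Algebra ℂ R]
    (m : ℕ) (Q : Fin (m + 1) → Fin (m + 1) → ℂ) (hQ0 : ∀ i j, Q i j ≠ 0)
    (hQ1 : ∀ i, Q i i = 1) (hQ2 : ∀ i j, Q j i = (Q i j)⁻¹)
    (a : Matrix (Fin (m + 1)) (Fin (m + 1)) R)
    -- the first m columns are 𝐪-Cartier–Foata, or the first m columns are 𝐪-right-quantum
    (hrel :
      (∀ i j k l : Fin (m + 1), i ≠ j → k ≠ Fin.last m → l ≠ Fin.last m →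
        (Q k l) • (a j l * a i k) = (Q i j) • (a i k * a j l)) ∨
      ((∀ i j k : Fin (m + 1), i < j → k ≠ Fin.last m →
          a j k * a i k = (Q i j) • (a i k * a j k)) ∧
        (∀ i j k l : Fin (m + 1), i < j → k < l → k ≠ Fin.last m → l ≠ Fin.last m →
          a i k * a j l - (Q i j)⁻¹ • (a j k * a i l) =
            (Q k l * (Q i j)⁻¹) • (a j l * a i k) - (Q k l) • (a i l * a j k))))
    -- A_{[mm]} : rescale row k (k < m) by q_{km}⁻¹
    (X : Matrix (Fin (m + 1)) (Fin (m + 1)) R)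
    (hX1 : (1 - Matrix.of fun k l =>
        if k = Fin.last m then a k l else (Q k (Fin.last m))⁻¹ • a k l) * X = 1)
    (hX2 : X * (1 - Matrix.of fun k l =>
        if k = Fin.last m then a k l else (Q k (Fin.last m))⁻¹ • a k l) = 1)
    (d : R)
    (hd1 : d * qdetDQ Q id Finset.univ a = 1)
    (hd2 : qdetDQ Q id Finset.univ a * d = 1) :
    X (Fin.last m) (Fin.last m) =
      d * qdetDQ Q Fin.castSucc Finset.univ
        (fun r c : Fin m => a r.castSucc c.castSucc) := by
  have hsymm : ∀ k, k ≠ Fin.last m → ∀ l, l ≠ Fin.last m → ∀ i j, i ≠ j →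
      a i k * a j l + Q k l • (a i l * a j k) =
        Q j i • (a j k * a i l + Q k l • (a j l * a i k)) :=
    fun k hk l hl i j hij => qRightQuantum_symm (U := (· ≠ Fin.last m)) hQ0 hQ1 hQ2 hrel hk hl hij
  have hA : (Matrix.of fun k l =>
      if k = Fin.last m then a k l else (Q k (Fin.last m))⁻¹ • a k l) =
      Matrix.of fun k l => (Q k (Fin.last m))⁻¹ • a k l := by
    ext k l
    by_cases hk : k = Fin.last m <;> simp [hk, hQ1]
  rw [hA] at hX1
  have hcramer := qAdjLast_self_eq_mul hQ0 hQ1 hQ2 Fin.le_last hsymm hX1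
  have hD : qdetDQ Q id Finset.univ a =
      ∑ J : Finset (Fin (m + 1)), (-1 : ℂ) ^ J.card • qMinor Q a J J :=
    qdetDQ_univ_eq_sum_qMinor Q (RelEmbedding.refl _) a
  have hD' : qdetDQ Q Fin.castSucc Finset.univ
      (fun r c : Fin m => a r.castSucc c.castSucc) = qAdjLast Q a (Fin.last m) (Fin.last m) := by
    refine Eq.trans ?_ (qAdjLast_self Fin.le_last).symm
    refine (qdetDQ_univ_eq_sum_qMinor Q Fin.castSuccOrderEmb _).trans ?_
    have hmem : ∀ (J : Finset (Fin m)) (x : Fin (m + 1)),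
        x ∈ J.map Fin.castSuccOrderEmb.toEmbedding ↔ ∃ y ∈ J, y.castSucc = x :=
      fun _ _ => Finset.mem_map
    refine Finset.sum_nbij (fun J => J.map Fin.castSuccOrderEmb.toEmbedding) ?_ ?_ ?_ ?_
    · intro J _
      rw [Finset.mem_filter, hmem]
      simp [Fin.castSucc_ne_last]
    · exact fun J _ J' _ h => Finset.map_injective _ h
    · intro K hK
      have hLK : Fin.last m ∉ K := (Finset.mem_filter.mp hK).2
      refine ⟨Finset.univ.filter (fun x => x.castSucc ∈ K), by simp, ?_⟩
      ext x
      rw [hmem]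
      induction x using Fin.lastCases <;> simp [hLK, Fin.castSucc_ne_last]
    · intro J _
      exact congrArg₂ (· • ·) (by rw [Finset.card_map])
        (qMinor_map Fin.castSuccOrderEmb hQ2 a J J).symm
  rw [hD', hcramer, ← hD, ← mul_assoc, hd1, one_mul]
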